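/- arXiv:2007.04315 — 2 statements merged into one kernel-verified Lean document; each statement's English description precedes it below -/
import Mathlib

section
/- The alternate convergents of the continued fraction expansion of 1 + 1/√3 are exactly the even-indexed terms 1, 3/2, 11/7, 41/26, 153/97, ... of the Veronese sequence; that is, defining x = 1 + 1/√3, the convergents p_k/q_k of its (simple) continued fraction, taken at every other index, agree with the sequence defined by α_{2m+2} = 2 − α_{2m}/(3α_{2m} − 1), α_0 = 1. -/
/-- The even-indexed subsequence of the Veronese sequence:
`β 0 = 1`, `β (m+1) = 2 - β m / (3 β m - 1)`. -/
noncomputable def evenVeronese : ℕ → ℝ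
  | 0 => 1
  | (m + 1) => 2 - evenVeronese m / (3 * evenVeronese m - 1)

/-- A convergent of `v` in terms of the complete quotient `w` after the partial quotient `a`. -/
theorem convs_succ_of_eq_add_inv {v w : ℝ} {a : ℤ} (hw : 1 < w) (h : v = a + w⁻¹) (n : ℕ) :
    (GenContFract.of v).convs (n + 1) = a + 1 / (GenContFract.of w).convs n := by
  have hfloor : ⌊v⌋ = a := by
    rw [Int.floor_eq_iff, h]
    exact ⟨by linarith [inv_pos.2 (zero_lt_one.trans hw)], by linarith [inv_lt_one_of_one_lt₀ hw]⟩
  have hfract : (Int.fract v)⁻¹ = w := by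
    rw [Int.fract, hfloor, h, add_sub_cancel_left, inv_inv]
  rw [GenContFract.convs_succ, hfloor, hfract]

theorem sqrt_three_bounds : 1 < √(3 : ℝ) ∧ √(3 : ℝ) < 2 :=
  ⟨by rw [Real.lt_sqrt] <;> norm_num, by rw [Real.sqrt_lt'] <;> norm_num⟩

theorem convs_half_sqrt_three_add_one_zero :
    (GenContFract.of ((√(3 : ℝ) + 1) / 2)).convs 0 = 1 := by
  have hfloor : ⌊(√(3 : ℝ) + 1) / 2⌋ = 1 := by
    rw [Int.floor_eq_iff]
    constructor <;> push_cast <;> linarith [sqrt_three_bounds.1, sqrt_three_bounds.2]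
  simp [GenContFract.of_h_eq_floor, hfloor]

theorem convs_half_sqrt_three_add_one_add_two (n : ℕ) :
    (GenContFract.of ((√(3 : ℝ) + 1) / 2)).convs (n + 2) =
      1 + 1 / (2 + 1 / (GenContFract.of ((√(3 : ℝ) + 1) / 2)).convs n) := by
  obtain ⟨h1, h2⟩ := sqrt_three_bounds
  have hsq : √(3 : ℝ) ^ 2 = 3 := Real.sq_sqrt (by norm_num)
  rw [convs_succ_of_eq_add_inv (a := 1) (w := √3 + 1) (by linarith) (by field_simp; grind),
    convs_succ_of_eq_add_inv (a := 2) (w := (√3 + 1) / 2) (by linarith) (by field_simp; grind)]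
  norm_num

theorem convs_one_add_inv_sqrt_three_add_two (n : ℕ) :
    (GenContFract.of (1 + 1 / √(3 : ℝ))).convs (n + 2) =
      1 + 1 / (1 + 1 / (GenContFract.of ((√(3 : ℝ) + 1) / 2)).convs n) := by
  obtain ⟨h1, h2⟩ := sqrt_three_bounds
  have hsq : √(3 : ℝ) ^ 2 = 3 := Real.sq_sqrt (by norm_num)
  rw [convs_succ_of_eq_add_inv (a := 1) (w := √3) h1 (by norm_num),
    convs_succ_of_eq_add_inv (a := 1) (w := (√3 + 1) / 2) (by linarith) (by field_simp; grind)]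
  norm_num

theorem convs_half_sqrt_three_add_one_pos (m : ℕ) :
    0 < (GenContFract.of ((√(3 : ℝ) + 1) / 2)).convs (2 * m) := by
  induction m with
  | zero => simp [-GenContFract.zeroth_conv_eq_h, convs_half_sqrt_three_add_one_zero]
  | succ m ih =>
    rw [mul_add_one, convs_half_sqrt_three_add_one_add_two]
    positivity

theorem evenVeronese_succ_eq_convs (m : ℕ) :
    evenVeronese (m + 1) =
      1 + 1 / (1 + 1 / (GenContFract.of ((√(3 : ℝ) + 1) / 2)).convs (2 * m)) := by
  induction m with
  | zero =>
    rw [mul_zero, convs_half_sqrt_three_add_one_zero]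
    norm_num [evenVeronese]
  | succ m ih =>
    have hc := convs_half_sqrt_three_add_one_pos m
    rw [evenVeronese, ih, mul_add_one, convs_half_sqrt_three_add_one_add_two]
    set c := (GenContFract.of ((√(3 : ℝ) + 1) / 2)).convs (2 * m)
    have hb : 1 + 1 / (1 + 1 / c) = (2 * c + 1) / (c + 1) := by field_simp; ring
    have hd : 3 * ((2 * c + 1) / (c + 1)) - 1 = (5 * c + 2) / (c + 1) := by field_simp; ring
    rw [hb, hd]
    field_simp
    ring

/-- The alternate (even-indexed) convergents of the simple continued fraction
expansion of `x = 1 + 1/√3` are exactly the even-indexed Veronese terms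
`1, 3/2, 11/7, 41/26, 153/97, …`. -/
theorem contfrac_convergents_eq_even_veronese :
    ∀ m : ℕ, (GenContFract.of (1 + 1 / Real.sqrt 3)).convs (2 * m) = evenVeronese m := by
  intro m
  cases m with
  | zero =>
    have hfloor : ⌊1 + 1 / √(3 : ℝ)⌋ = 1 := by
      have h := sqrt_three_bounds.1
      rw [Int.floor_eq_iff]
      constructor
      · simp
      · have := inv_lt_one_of_one_lt₀ h
        rw [one_div]
        push_cast
        linarith
    rw [mul_zero, GenContFract.zeroth_conv_eq_h, GenContFract.of_h_eq_floor, hfloor]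
    simp [evenVeronese]
  | succ m => rw [mul_add_one, convs_one_add_inv_sqrt_three_add_two, evenVeronese_succ_eq_convs]
end

section
/- There exists an outer automorphism ζ of the symmetric group S₆ (i.e., an automorphism not of the form conjugation by an element), and under any such automorphism the image of every transposition is a permutation of cycle type 2+2+2 (a product of three disjoint transpositions). -/
open Equiv

/-- An automorphism of a group is inner if it is conjugation by some element. -/
def IsInner {G : Type*} [Group G] (ζ : MulAut G) : Prop :=
  ∃ g : G, ∀ x : G, ζ x = g * x * g⁻¹

/-- An action permuting the values of an injective family induces an action on the indices. -/
theorem exists_permHom_of_injective {G ι β : Type*} [Group G] [MulAction G β] {T : ι → β}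
    (hT : Function.Injective T) (h : ∀ (g : G) (i : ι), ∃ j, g • T i = T j) :
    ∃ f : G →* Perm ι, ∀ g i, T (f g i) = g • T i := by
  choose F hF using h
  refine ⟨MonoidHom.toHomPerm
    { toFun := F
      map_one' := funext fun i => hT (by rw [← hF, one_smul]; rfl)
      map_mul' := fun g g' => funext fun i => hT (by
        rw [← hF, mul_smul, hF, hF]; rfl) }, fun g i => ?_⟩
  exact (hF g i).symm

open scoped Pointwise in
/-- The totals of six points: `total 0` consists of five synthemes that together contain each duad
once, and the other totals are its conjugates by the transpositions `(0 i)`. -/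
def total (i : Fin 6) : Finset (Perm (Fin 6)) :=
  ConjAct.toConjAct (swap 0 i) •
    ({swap 0 1 * swap 2 3 * swap 4 5, swap 0 2 * swap 1 4 * swap 3 5,
      swap 0 3 * swap 1 5 * swap 2 4, swap 0 4 * swap 1 3 * swap 2 5,
      swap 0 5 * swap 1 2 * swap 3 4} : Finset (Perm (Fin 6)))

theorem total_injective : Function.Injective total := by
  unfold Function.Injective
  decide +kernel

open scoped Pointwise in
theorem toConjAct_smul_total (σ : Perm (Fin 6)) (i : Fin 6) :
    ∃ j, ConjAct.toConjAct σ • total i = total j := by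
  have h : ∀ (k : Fin 5) (i : Fin 6),
      ∃ j, ConjAct.toConjAct (swap k.castSucc k.succ) • total i = total j := by
    decide +kernel
  have hσ : σ ∈ Submonoid.closure (Set.range fun k : Fin 5 => swap k.castSucc k.succ) := by
    rw [Perm.mclosure_swap_castSucc_succ]
    trivial
  induction hσ using Submonoid.closure_induction generalizing i with
  | mem τ hτ =>
    obtain ⟨k, rfl⟩ := hτ
    exact h k i
  | one => exact ⟨i, by simp⟩
  | mul τ ρ _ _ hτ hρ =>
    obtain ⟨j, hj⟩ := hρ i
    obtain ⟨l, hl⟩ := hτ j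
    exact ⟨l, by rw [map_mul, mul_smul, hj, hl]⟩

open scoped Pointwise in
theorem toConjAct_swap_smul_total_ne (i : Fin 6) :
    ConjAct.toConjAct (swap (0 : Fin 6) 1) • total i ≠ total i := by
  revert i
  decide +kernel

open scoped Pointwise in
theorem toConjAct_swap_mul_swap_smul_total_ne :
    ConjAct.toConjAct (swap (0 : Fin 6) 1 * swap 0 2) • total 0 ≠ total 0 := by
  decide +kernel

open scoped Pointwise in
theorem exists_not_isInner : ∃ ζ : MulAut (Perm (Fin 6)), ¬ IsInner ζ := by
  obtain ⟨f, hf⟩ := exists_permHom_of_injective (G := ConjAct (Perm (Fin 6)))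
    total_injective (fun g i => toConjAct_smul_total (ConjAct.ofConjAct g) i)
  set φ : Perm (Fin 6) →* Perm (Fin 6) := f.comp ConjAct.toConjAct.toMonoidHom
  have hker : φ.ker = ⊥ := by
    by_contra hne
    have hle := Perm.alternatingGroup_le_of_normal (N := φ.ker) (by simp)
      ((Subgroup.nontrivial_iff_ne_bot _).2 hne)
    have hmem : swap 0 1 * swap 0 2 ∈ φ.ker := hle (by
      rw [Perm.mem_alternatingGroup]
      decide +kernel)
    apply toConjAct_swap_mul_swap_smul_total_ne
    have h := DFunLike.congr_fun (MonoidHom.mem_ker.1 hmem) 0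
    rw [← hf]
    exact congrArg total h
  have hinj : Function.Injective φ := (MonoidHom.ker_eq_bot_iff φ).1 hker
  refine ⟨MulEquiv.ofBijective φ (Finite.injective_iff_bijective.1 hinj), ?_⟩
  rintro ⟨g, hg⟩
  apply toConjAct_swap_smul_total_ne (g 2)
  have h : φ (swap 0 1) (g 2) = g 2 := by
    have := DFunLike.congr_fun (hg (swap 0 1)) (g 2)
    simpa [swap_apply_of_ne_of_ne] using this
  rw [← hf]
  exact congrArg total h

/-- Two non-commuting transpositions move exactly one common point. -/
theorem exists_eq_swap_of_not_commute {α : Type*} [DecidableEq α] {p q : Perm α}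
    (hp : p.IsSwap) (hq : q.IsSwap) (h : ¬ Commute p q) :
    ∃ a b c, a ≠ b ∧ a ≠ c ∧ b ≠ c ∧ p = swap a b ∧ q = swap a c := by
  obtain ⟨a, b, hab, rfl⟩ := hp
  obtain ⟨c, d, hcd, rfl⟩ := hq
  have hd : ¬ [a, b, c, d].Nodup := fun hd => h (Perm.disjoint_swap_swap hd).commute
  have hne : swap a b ≠ swap c d := fun e => h (e ▸ Commute.refl _)
  by_cases hac : a = c
  · subst hac
    exact ⟨a, b, d, hab, hcd, by grind, rfl, rfl⟩
  by_cases had : a = d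
  · subst had
    exact ⟨a, b, c, hab, hac, by grind [swap_comm], rfl, swap_comm _ _⟩
  by_cases hbc : b = c
  · subst hbc
    exact ⟨b, a, d, hab.symm, hcd, had, swap_comm _ _, rfl⟩
  have hbd : b = d := by grind
  subst hbd
  exact ⟨b, a, c, hab.symm, hcd.symm, hac, swap_comm _ _, swap_comm _ _⟩

theorem swap_not_commute_swap {α : Type*} [DecidableEq α] {a b c : α}
    (hab : a ≠ b) (hac : a ≠ c) (hbc : b ≠ c) : ¬ Commute (swap a b) (swap a c) := by
  intro h
  have := DFunLike.congr_fun h.eq a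
  simp only [Perm.mul_apply, swap_apply_left, swap_apply_of_ne_of_ne hac.symm hbc.symm,
    swap_apply_of_ne_of_ne hab.symm hbc] at this
  exact hbc this.symm

theorem swap_mul_swap_mul_swap_inv {α : Type*} [DecidableEq α] {a b c : α}
    (hac : a ≠ c) (hbc : b ≠ c) : swap a b * swap a c * (swap a b)⁻¹ = swap b c := by
  rw [← swap_apply_apply, swap_apply_left, swap_apply_of_ne_of_ne hac.symm hbc.symm]

theorem swap_right_injective {α : Type*} [DecidableEq α] (a : α) :
    Function.Injective (swap a) := fun b c h => by
  simpa using DFunLike.congr_fun h a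

theorem isInner_of_isSwap_map {α : Type*} [Finite α] [DecidableEq α] (ζ : MulAut (Perm α))
    (hζ : ∀ t : Perm α, t.IsSwap → (ζ t).IsSwap) {x y z : α}
    (hxy : x ≠ y) (hxz : x ≠ z) (hyz : y ≠ z) : IsInner ζ := by
  have hmap {i j : α} (hij : i ≠ j) : (ζ (swap i j)).IsSwap := hζ _ ⟨i, j, hij, rfl⟩
  have hcomm {i j : α} (hi : x ≠ i) (hj : x ≠ j) (hij : i ≠ j) :
      ¬ Commute (ζ (swap x i)) (ζ (swap x j)) := by
    rw [commute_map_iff ζ.injective]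
    exact swap_not_commute_swap hi hj hij
  obtain ⟨a, b, c, hab, hac, hbc, hb, hc⟩ :=
    exists_eq_swap_of_not_commute (hmap hxy) (hmap hxz) (hcomm hxy hxz hyz)
  have key (k : α) : ∃ d, ζ (swap x k) = swap a d := by
    by_cases hxk : x = k
    · exact ⟨a, by subst hxk; simp [← Perm.one_def]⟩
    by_cases hyk : y = k
    · exact ⟨b, hyk ▸ hb⟩
    by_cases hzk : z = k
    · exact ⟨c, hzk ▸ hc⟩
    have h₁ := hcomm hxy hxk hyk
    have h₂ := hcomm hxz hxk hzk
    obtain ⟨u, v, huv, h⟩ := hmap hxk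
    have hne : swap u v ≠ swap b c := by
      intro e
      have hyzk : swap x k = swap y z := ζ.injective <| by
        rw [h, e, ← swap_mul_swap_mul_swap_inv hxz hyz, map_mul, map_mul, map_inv, hb, hc,
          swap_mul_swap_mul_swap_inv hac hbc]
      have := DFunLike.congr_fun hyzk x
      rw [swap_apply_left, swap_apply_of_ne_of_ne hxy hxz] at this
      exact hxk this.symm
    rw [h, hb] at h₁
    rw [h, hc] at h₂
    have d₁ : ¬ [a, b, u, v].Nodup := fun hd => h₁ (Perm.disjoint_swap_swap hd).commute
    have d₂ : ¬ [a, c, u, v].Nodup := fun hd => h₂ (Perm.disjoint_swap_swap hd).commute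
    by_cases hua : u = a
    · exact ⟨v, by rw [h, hua]⟩
    by_cases hva : v = a
    · exact ⟨u, by rw [h, hva, swap_comm]⟩
    have hvu := swap_comm u v
    grind
  choose g hg using key
  have hginj : Function.Injective g := fun i j hij =>
    swap_right_injective x (ζ.injective (by rw [hg, hg, hij]))
  have hgx : g x = a := by
    apply swap_right_injective a
    rw [← hg]
    simp [← Perm.one_def]
  let γ : Perm α := Equiv.ofBijective g (Finite.injective_iff_bijective.1 hginj)
  have hstar (k : α) : ζ (swap x k) = MulAut.conj γ (swap x k) := by
    rw [hg, MulAut.conj_apply, ← swap_apply_apply]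
    simp [γ, hgx]
  refine ⟨γ, fun σ => ?_⟩
  suffices h : ζ.toMonoidHom = (MulAut.conj γ).toMonoidHom from DFunLike.congr_fun h σ
  refine MonoidHom.eq_of_eqOn_dense Perm.closure_isSwap ?_
  rintro _ ⟨i, j, hij, rfl⟩
  change ζ (swap i j) = MulAut.conj γ (swap i j)
  by_cases hxi : x = i
  · exact hxi ▸ hstar j
  by_cases hxj : x = j
  · rw [swap_comm]
    exact hxj ▸ hstar i
  rw [← swap_mul_swap_mul_swap_inv hxj hij]
  simp only [map_mul, map_inv, hstar]

theorem sign_mulAut_apply {α : Type*} [Fintype α] [DecidableEq α] [Nontrivial α]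
    (ζ : MulAut (Perm α)) (σ : Perm α) : Perm.sign (ζ σ) = Perm.sign σ :=
  DFunLike.congr_fun (Perm.eq_sign_of_surjective_hom (s := Perm.sign.comp ζ.toMonoidHom)
    ((Perm.sign_surjective α).comp ζ.surjective)) σ

/-- `S₆` has an outer automorphism, and under any outer automorphism of `S₆` every
transposition is sent to a permutation of cycle type `2+2+2`. -/
theorem s6_outer_automorphism :
    (∃ ζ : MulAut (Perm (Fin 6)), ¬ IsInner ζ) ∧
    (∀ ζ : MulAut (Perm (Fin 6)), ¬ IsInner ζ →
      ∀ t : Perm (Fin 6), t.IsSwap → (ζ t).cycleType = {2, 2, 2}) := by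
  refine ⟨exists_not_isInner, fun ζ hζ t ht => ?_⟩
  have hnot : ¬ (ζ t).IsSwap := by
    refine fun h => hζ (isInner_of_isSwap_map ζ (fun s hs => ?_)
      (x := 0) (y := 1) (z := 2) (by decide) (by decide) (by decide))
    obtain ⟨i, j, hij, rfl⟩ := ht
    obtain ⟨k, l, hkl, rfl⟩ := hs
    rw [Perm.isSwap_iff_cycleType] at h ⊢
    rw [← h, ← Perm.isConj_iff_cycleType_eq]
    exact ζ.toMonoidHom.map_isConj (Perm.isConj_swap hkl hij)
  have hpow : ζ t ^ 2 = 1 := by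
    rw [← map_pow, ← ht.orderOf, pow_orderOf_eq_one, map_one]
  have hsign : Perm.sign (ζ t) = -1 := by rw [sign_mulAut_apply, ht.sign_eq]
  have htype := Perm.cycleType_of_pow_prime_eq_one hpow
  rw [Perm.isSwap_iff_cycleType] at hnot
  have hle := Perm.sum_cycleType_le (ζ t)
  rw [Perm.sign_of_cycleType] at hsign
  generalize (ζ t).cycleType.card = n at htype
  rw [htype] at hnot hle hsign ⊢
  have hn : n ≤ 3 := by
    simp at hle
    omega
  interval_cases n
  · simp at hsign
  · simp at hnot
  · revert hsign
    decide
  · rfl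
end
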